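/- arXiv:math/0304350 — 3 statements merged into one kernel-verified Lean document; each statement's English description precedes it below -/
import Mathlib

section
/- Let L_1, …, L_n be simple closure spaces, L_i on Σ_i, let x_i be a coatom of L_i for each i, and let L ∈ S(L_1,…,L_n) be a weak tensor product. Then X := ⋃_{i=1}^n π_i⁻¹(x_i) is a coatom of L. -/
open Set

namespace QLTensor

universe u v w

/-- A simple closure space on `X`: a set of subsets of `X`, closed under arbitrary
set-intersections, containing `∅`, `univ` and all singletons. -/
def IsSCS {X : Type*} (L : Set (Set X)) : Prop :=
  (∀ ω ⊆ L, ⋂₀ ω ∈ L) ∧ ∅ ∈ L ∧ Set.univ ∈ L ∧ ∀ p : X, ({p} : Set X) ∈ L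

/-- The join in a simple closure space: `⋁ A = ⋂ {b ∈ L | A ⊆ b}`. -/
def cl {X : Type*} (L : Set (Set X)) (A : Set X) : Set X :=
  ⋂₀ {b | b ∈ L ∧ A ⊆ b}

/-- `b` covers `a` in the lattice `L` (both belonging to `L`). -/
def CoversIn {X : Type*} (L : Set (Set X)) (a b : Set X) : Prop :=
  a ∈ L ∧ b ∈ L ∧ a ⊂ b ∧ ∀ c ∈ L, a ⊂ c → c ⊂ b → False

/-- `x` is a coatom of `L` (covered by the top element `univ`). -/
def IsCoatomIn {X : Type*} (L : Set (Set X)) (x : Set X) : Prop :=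
  x ∈ L ∧ x ≠ Set.univ ∧ ∀ c ∈ L, x ⊂ c → c = Set.univ

/-- `L` is coatomistic: every element is an intersection of coatoms. -/
def Coatomistic {X : Type*} (L : Set (Set X)) : Prop :=
  ∀ a ∈ L, a = ⋂₀ {x | IsCoatomIn L x ∧ a ⊆ x}

/-- The covering property: if `p ∧ a = 0` then `p ∨ a` covers `a`. -/
def CovProp {X : Type*} (L : Set (Set X)) : Prop :=
  ∀ p : X, ∀ a ∈ L, p ∉ a → CoversIn L a (cl L (insert p a))

/-- The covering property of the dual lattice. -/
def DualCovProp {X : Type*} (L : Set (Set X)) : Prop :=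
  ∀ x : Set X, IsCoatomIn L x → ∀ a ∈ L, cl L (a ∪ x) = Set.univ →
    CoversIn L (a ∩ x) a

/-- A DAC-lattice: `L` and its dual are atomistic with the covering property
(a simple closure space is automatically atomistic). -/
def IsDAC {X : Type*} (L : Set (Set X)) : Prop :=
  CovProp L ∧ Coatomistic L ∧ DualCovProp L

/-- `(a, b)` is a modular pair: `(c ∨ a) ∧ b = c ∨ (a ∧ b)` for all `c ≤ b`. -/
def ModularPairIn {X : Type*} (L : Set (Set X)) (a b : Set X) : Prop :=
  ∀ c ∈ L, c ⊆ b → cl L (c ∪ a) ∩ b = cl L (c ∪ a ∩ b)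

/-- `z` is a central element of the simple closure space `L`. -/
def IsCentralIn {X : Type*} (L : Set (Set X)) (z : Set X) : Prop :=
  zᶜ ∈ L ∧ ModularPairIn L z zᶜ ∧ ModularPairIn L zᶜ z

/-- `L` is irreducible: its only central elements are `∅` and `univ`. -/
def IrreducibleSCS {X : Type*} (L : Set (Set X)) : Prop :=
  ∀ z ∈ L, IsCentralIn L z → z = ∅ ∨ z = Set.univ

/-- `N` is an orthocomplementation of the simple closure space `L`. -/
def IsOrtho {X : Type*} (L : Set (Set X)) (N : Set X → Set X) : Prop :=
  (∀ a ∈ L, N a ∈ L) ∧ (∀ a ∈ L, N (N a) = a) ∧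
  (∀ a ∈ L, ∀ b ∈ L, a ⊆ b → N b ⊆ N a) ∧
  ∀ a ∈ L, cl L (a ∪ N a) = Set.univ

/-- `L` with orthocomplementation `N` is orthomodular. -/
def OrthomodularIn {X : Type*} (L : Set (Set X)) (N : Set X → Set X) : Prop :=
  ∀ a ∈ L, ∀ b ∈ L, a ⊆ b → b = cl L (a ∪ b ∩ N a)

/-- `L` contains `MO₃`. -/
def ContainsMO3 {X : Type*} (L : Set (Set X)) : Prop :=
  ∃ p q r : X, p ≠ q ∧ p ≠ r ∧ q ≠ r ∧
    CoversIn L {p} (cl L {p, q}) ∧ CoversIn L {q} (cl L {p, q}) ∧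
    CoversIn L {r} (cl L {p, q})

/-- `L` contains `MO₄`. -/
def ContainsMO4 {X : Type*} (L : Set (Set X)) : Prop :=
  ∃ p₁ p₂ p₃ p₄ : X,
    p₁ ≠ p₂ ∧ p₁ ≠ p₃ ∧ p₁ ≠ p₄ ∧ p₂ ≠ p₃ ∧ p₂ ≠ p₄ ∧ p₃ ≠ p₄ ∧
    CoversIn L {p₁} (cl L {p₁, p₄}) ∧ CoversIn L {p₂} (cl L {p₁, p₄}) ∧
    CoversIn L {p₃} (cl L {p₁, p₄}) ∧ CoversIn L {p₄} (cl L {p₁, p₄})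

/-- `L` is connected. -/
def ConnectedSCS {X : Type*} (L : Set (Set X)) : Prop :=
  (∃ p q : X, p ≠ q) ∧
  ∀ p q : X, p ≠ q → ∃ r : X, r ≠ p ∧ r ≠ q ∧ r ∈ cl L {p, q} ∧
    p ∈ cl L {q, r} ∧ q ∈ cl L {p, r}

/-- `L` is weakly connected: `L ≠ 2` and the point set admits a connected covering. -/
def WeaklyConnected {X : Type*} (L : Set (Set X)) : Prop :=
  (∃ p q : X, p ≠ q) ∧
  ∃ 𝒜 : Set (Set X),
    ⋃₀ 𝒜 = Set.univ ∧
    (∀ A ∈ 𝒜, ∃ p ∈ A, ∃ q ∈ A, p ≠ q) ∧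
    (∀ A ∈ 𝒜, ∀ p ∈ A, ∀ q ∈ A, p ≠ q → ∃ r, r ≠ p ∧ r ≠ q ∧ r ∈ cl L {p, q}) ∧
    ∀ p q : X, ∃ (m : ℕ) (c : Fin (m + 1) → Set X),
      (∀ i, c i ∈ 𝒜) ∧ p ∈ c 0 ∧ q ∈ c (Fin.last m) ∧
      ∀ i : Fin m, ∃ x ∈ c i.castSucc ∩ c i.succ, ∃ y ∈ c i.castSucc ∩ c i.succ, x ≠ y

/-- The central cover `e(p)` of an atom `p`. -/
def centralCover {X : Type*} (L : Set (Set X)) (p : X) : Set X :=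
  ⋂₀ {z | z ∈ L ∧ IsCentralIn L z ∧ p ∈ z}

/-- The interval `[0, e]` of `L`, viewed as a simple closure space on `e`. -/
def restrictSCS {X : Type*} (L : Set (Set X)) (e : Set X) : Set (Set ↥e) :=
  {B | Subtype.val '' B ∈ L}

/-- The automorphism group of `M` acts transitively on points. -/
def TransitiveSCS {X : Type*} (M : Set (Set X)) : Prop :=
  ∀ p q : X, ∃ u : X ≃ X, (∀ a : Set X, a ∈ M ↔ u '' a ∈ M) ∧ u p = q

section Pi

variable {Ω : Type*} {σ : Ω → Type*}

/-- `⋃_α π_α⁻¹ (a α)`. -/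
def unionCyl (a : ∀ α, Set (σ α)) : Set (∀ α, σ α) :=
  {p | ∃ α, p α ∈ a α}

/-- `∏_α a_α`. -/
def prodSet (a : ∀ α, Set (σ α)) : Set (∀ α, σ α) :=
  {p | ∀ α, p α ∈ a α}

/-- `p[A, β]`. -/
def cylSet (p : ∀ α, σ α) (β : Ω) (A : Set (σ β)) : Set (∀ α, σ α) :=
  {q | q β ∈ A ∧ ∀ α, α ≠ β → q α = p α}

/-- `R_β[p]`. -/
def secSet (R : Set (∀ α, σ α)) (β : Ω) (p : ∀ α, σ α) : Set (σ β) :=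
  {x | ∃ q ∈ R, q β = x ∧ ∀ α, α ≠ β → q α = p α}

/-- The separated product `∧○_α L_α`. -/
def wedgeO (L : ∀ α, Set (Set (σ α))) : Set (Set (∀ α, σ α)) :=
  {S | ∃ ω : Set (Set (∀ α, σ α)),
    (∀ y ∈ ω, ∃ a : ∀ α, Set (σ α), (∀ α, a α ∈ L α) ∧ y = unionCyl a) ∧ S = ⋂₀ ω}

/-- The product `∨○_α L_α`. -/
def veeO (L : ∀ α, Set (Set (σ α))) : Set (Set (∀ α, σ α)) :=
  {R | ∀ (β : Ω) (p : ∀ α, σ α), secSet R β p ∈ L β}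

/-- Axiom P2. -/
def AxiomP2 (L : ∀ α, Set (Set (σ α))) (M : Set (Set (∀ α, σ α))) : Prop :=
  ∀ a : ∀ α, Set (σ α), (∀ α, a α ∈ L α) → unionCyl a ∈ M

/-- Axiom P3. -/
def AxiomP3 (L : ∀ α, Set (Set (σ α))) (M : Set (Set (∀ α, σ α))) : Prop :=
  ∀ (p : ∀ α, σ α) (β : Ω) (A : Set (σ β)), cylSet p β A ∈ M → A ∈ L β

/-- `M` is a weak tensor product of the family `L`, i.e. `M ∈ S(L_α, α ∈ Ω)`. -/
def IsWTP (L : ∀ α, Set (Set (σ α))) (M : Set (Set (∀ α, σ α))) : Prop :=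
  IsSCS M ∧ AxiomP2 L M ∧ AxiomP3 L M

/-- `p # q` iff `p_β ⊥_β q_β` for some `β`. -/
def hashRel (N : ∀ α, Set (σ α) → Set (σ α)) (p q : ∀ α, σ α) : Prop :=
  ∃ β, p β ∈ N β {q β}

/-- `R^#`. -/
def sharp (N : ∀ α, Set (σ α) → Set (σ α)) (R : Set (∀ α, σ α)) :
    Set (∀ α, σ α) :=
  {q | ∀ p ∈ R, hashRel N q p}

/-- A join-preserving map `u` is large. -/
def LargeMap (u : Set (∀ α, σ α) → Set (∀ α, σ α)) : Prop :=
  ∀ (β : Ω) (p : ∀ α, σ α),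
    (¬ ∃ x, u (cylSet p β Set.univ) = {x}) ∧ ¬ u Set.univ ⊆ {q | q β = p β}

end Pi

section Binary

variable {X Y : Type*}

/-- The binary product `L₁ ∨○ L₂`. -/
def veeO2 (L1 : Set (Set X)) (L2 : Set (Set Y)) : Set (Set (X × Y)) :=
  {R | (∀ y : Y, {x | (x, y) ∈ R} ∈ L1) ∧ ∀ x : X, {y | (x, y) ∈ R} ∈ L2}

/-- The binary separated product `L₁ ∧○ L₂`. -/
def wedgeO2 (L1 : Set (Set X)) (L2 : Set (Set Y)) : Set (Set (X × Y)) :=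
  {S | ∃ ω : Set (Set (X × Y)),
    (∀ y ∈ ω, ∃ a₁ ∈ L1, ∃ a₂ ∈ L2,
      y = a₁ ×ˢ (Set.univ : Set Y) ∪ (Set.univ : Set X) ×ˢ a₂) ∧
    S = ⋂₀ ω}

end Binary

/-- The full cylinder `p[univ, β]` belongs to every weak tensor product. -/
theorem IsWTP.cylSet_univ_mem {Ω : Type*} {σ : Ω → Type*} {L : ∀ α, Set (Set (σ α))}
    {M : Set (Set (∀ α, σ α))} (hL : ∀ α, IsSCS (L α)) (hM : IsWTP L M)
    (p : ∀ α, σ α) (β : Ω) : cylSet p β Set.univ ∈ M := by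
  classical
  have key : cylSet p β Set.univ =
      ⋂₀ {S | ∃ α, α ≠ β ∧ S = unionCyl (Function.update (fun γ => (∅ : Set (σ γ))) α {p α})} := by
    ext q
    simp only [cylSet, Set.mem_univ, true_and, Set.mem_ofPred_eq, Set.mem_sInter, unionCyl]
    constructor
    · rintro h S ⟨α, hα, rfl⟩
      exact ⟨α, by simp [h α hα]⟩
    · intro h α hα
      obtain ⟨γ, hγ⟩ := h _ ⟨α, hα, rfl⟩
      by_cases hγα : γ = α
      · subst hγα
        simpa using hγ
      · simp [Function.update_of_ne hγα] at hγ
  rw [key]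
  refine hM.1.1 _ ?_
  rintro S ⟨α, -, rfl⟩
  refine hM.2.1 _ fun γ => ?_
  by_cases hγα : γ = α
  · subst hγα
    simpa using (hL γ).2.2.2 (p γ)
  · simpa [Function.update_of_ne hγα] using (hL γ).2.1

/-- One-coordinate sections of elements of a weak tensor product are closed. -/
theorem IsWTP.section_mem {Ω : Type*} [DecidableEq Ω] {σ : Ω → Type*}
    {L : ∀ α, Set (Set (σ α))} {M : Set (Set (∀ α, σ α))} (hL : ∀ α, IsSCS (L α))
    (hM : IsWTP L M) {c : Set (∀ α, σ α)} (hc : c ∈ M) (p : ∀ α, σ α) (β : Ω) :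
    {a | Function.update p β a ∈ c} ∈ L β := by
  refine hM.2.2 p β _ ?_
  have key : cylSet p β {a | Function.update p β a ∈ c} = ⋂₀ {c, cylSet p β Set.univ} := by
    ext q
    simp only [cylSet, Set.mem_ofPred_eq, Set.mem_univ, true_and, Set.sInter_insert,
      Set.sInter_singleton, Set.mem_inter_iff]
    refine and_congr_left fun h => ?_
    rw [← Function.eq_update_iff.2 ⟨rfl, h⟩]
  rw [key]
  refine hM.1.1 _ ?_
  rintro S (rfl | rfl)
  · exact hc
  · exact hM.cylSet_univ_mem hL p β

/-- if `x_i` is a coatom of `L_i` for each `i`, then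
`X = ⋃_i π_i⁻¹(x_i)` is a coatom of any weak tensor product `M ∈ S(L₁,…,L_n)`. -/
theorem stmt15 {n : ℕ} {σ : Fin n → Type*} [∀ i, Nonempty (σ i)]
    (L : ∀ i, Set (Set (σ i))) (hL : ∀ i, IsSCS (L i))
    (M : Set (Set (∀ i, σ i))) (hM : IsWTP L M)
    (x : ∀ i, Set (σ i)) (hx : ∀ i, IsCoatomIn (L i) (x i)) :
    IsCoatomIn M (unionCyl x) := by
  classical
  refine ⟨hM.2.1 x fun i => (hx i).1, ?_, ?_⟩
  · choose p hp using fun i => (Set.ne_univ_iff_exists_notMem (x i)).1 (hx i).2.1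
    intro h
    obtain ⟨i, hi⟩ := h.ge (Set.mem_univ p)
    exact hp i hi
  · intro c hc hxc
    obtain ⟨p, hpc, hpx⟩ := Set.exists_of_ssubset hxc
    have update_mem : ∀ r ∈ c, ∀ i, r i ∉ x i → ∀ a, Function.update r i a ∈ c := by
      intro r hr i hi a
      have huniv : {a | Function.update r i a ∈ c} = Set.univ := by
        refine (hx i).2.2 _ (hM.section_mem hL hc r i) ?_
        refine (Set.ssubset_iff_of_subset fun b hb => ?_).2 ⟨r i, by simpa using hr, hi⟩
        exact hxc.1 ⟨i, by simpa using hb⟩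
      exact huniv.ge (Set.mem_univ a)
    refine Set.eq_univ_of_forall fun q => ?_
    by_cases hq : q ∈ unionCyl x
    · exact hxc.1 hq
    have piecewise_mem : ∀ s : Finset (Fin n), s.piecewise q p ∈ c := by
      intro s
      induction s using Finset.induction_on with
      | empty => simpa using hpc
      | insert i s his ih =>
        rw [Finset.piecewise_insert]
        refine update_mem _ ih i ?_ _
        rw [Finset.piecewise_eq_of_notMem _ _ _ his]
        exact fun hi => hpx ⟨i, hi⟩
    simpa using piecewise_mem Finset.univ

end QLTensor
end

section
/- Let {L_α}_{α∈Ω} be orthocomplemented simple closure spaces, L_α on Σ_α. If ∧○_α L_α (equipped with the orthocomplementation R ↦ R^#, where p # q iff p_β ⊥_β q_β for some β) has the covering property or is orthomodular, then there is at most one β ∈ Ω with L_β ≠ 2^{Σ_β}. -/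
open Set

namespace QLTensor

universe u v w

namespace IsOrtho

variable {X : Type*} {L : Set (Set X)} {N : Set X → Set X}

theorem apply_empty (hL : IsSCS L) (hN : IsOrtho L N) : N ∅ = Set.univ := by
  obtain ⟨h1, h2, h3, -⟩ := hN
  have h := h3 ∅ hL.2.1 (N Set.univ) (h1 _ hL.2.2.1) (Set.empty_subset _)
  rw [h2 _ hL.2.2.1] at h
  exact Set.univ_subset_iff.1 h

theorem apply_univ (hL : IsSCS L) (hN : IsOrtho L N) : N Set.univ = ∅ := by
  rw [← hN.apply_empty hL, hN.2.1 _ hL.2.1]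

theorem notMem_self (hL : IsSCS L) (hN : IsOrtho L N) (p : X) : p ∉ N {p} := by
  intro hp
  have hs := hL.2.2.2 p
  have hu : N {p} = Set.univ := by
    apply Set.univ_subset_iff.1
    rw [← hN.2.2.2 _ hs]
    exact Set.sInter_subset_of_mem
      ⟨hN.1 _ hs, Set.union_subset (Set.singleton_subset_iff.2 hp) subset_rfl⟩
  have he := hN.2.1 _ hs
  rw [hu, hN.apply_univ hL] at he
  exact Set.singleton_ne_empty p he.symm

theorem mem_symm (hL : IsSCS L) (hN : IsOrtho L N) {p q : X} (h : p ∈ N {q}) : q ∈ N {p} := by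
  have h' := hN.2.2.1 _ (hL.2.2.2 p) _ (hN.1 _ (hL.2.2.2 q)) (Set.singleton_subset_iff.2 h)
  rw [hN.2.1 _ (hL.2.2.2 q)] at h'
  exact Set.singleton_subset_iff.1 h'

theorem eq_of_subset (hL : IsSCS L) (hN : IsOrtho L N) {p q : X} (h : N {p} ⊆ N {q}) : q = p := by
  have h' := hN.2.2.1 _ (hN.1 _ (hL.2.2.2 p)) _ (hN.1 _ (hL.2.2.2 q)) h
  rw [hN.2.1 _ (hL.2.2.2 q), hN.2.1 _ (hL.2.2.2 p)] at h'
  exact Set.singleton_subset_singleton.1 h'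

theorem exists_mem_notMem (hL : IsSCS L) (hN : IsOrtho L N) {p q : X} (h : q ≠ p) :
    ∃ x ∈ N {p}, x ∉ N {q} :=
  Set.not_subset.1 fun hs => h (hN.eq_of_subset hL hs)

theorem exists_subset_singleton (hL : IsSCS L) (hN : IsOrtho L N) {c : Set X} (hc : c ∈ L)
    (hne : c ≠ Set.univ) : ∃ s, c ⊆ N {s} := by
  have hNc : (N c).Nonempty := by
    rw [Set.nonempty_iff_ne_empty]
    intro he
    have h := hN.2.1 _ hc
    rw [he, hN.apply_empty hL] at h
    exact hne h.symm
  obtain ⟨s, hs⟩ := hNc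
  have h := hN.2.2.1 _ (hL.2.2.2 s) _ (hN.1 _ hc) (Set.singleton_subset_iff.2 hs)
  rw [hN.2.1 _ hc] at h
  exact ⟨s, h⟩

theorem exists_ne_not_orthogonal (hL : IsSCS L) (hN : IsOrtho L N) (h : L ≠ Set.univ) :
    ∃ p q : X, p ≠ q ∧ p ∉ N {q} := by
  by_contra! hc
  refine h (Set.eq_univ_of_forall fun A => ?_)
  have hA : A = ⋂₀ {b | ∃ q, q ∉ A ∧ b = N {q}} := by
    ext x
    constructor
    · rintro hx b ⟨q, hq, rfl⟩
      exact hc x q fun e => hq (e ▸ hx)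
    · intro hx
      by_contra hxA
      exact hN.notMem_self hL x (hx _ ⟨x, hxA, rfl⟩)
  rw [hA]
  apply hL.1
  rintro b ⟨q, -, rfl⟩
  exact hN.1 _ (hL.2.2.2 q)

end IsOrtho

section Sharp

variable {Ω : Type*} {σ : Ω → Type*} {L : ∀ α, Set (Set (σ α))}
  {N : ∀ α, Set (σ α) → Set (σ α)}

theorem sharp_mem_wedgeO (hL : ∀ α, IsSCS (L α)) (hN : ∀ α, IsOrtho (L α) (N α))
    (R : Set (∀ α, σ α)) : sharp N R ∈ wedgeO L := by
  refine ⟨{y | ∃ p ∈ R, y = unionCyl fun α => N α {p α}}, ?_, ?_⟩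
  · rintro y ⟨p, -, rfl⟩
    exact ⟨_, fun α => (hN α).1 _ ((hL α).2.2.2 _), rfl⟩
  · ext q
    constructor
    · rintro hq y ⟨p, hp, rfl⟩
      exact hq p hp
    · intro hq p hp
      exact hq _ ⟨p, hp, rfl⟩

theorem hashRel_symm (hL : ∀ α, IsSCS (L α)) (hN : ∀ α, IsOrtho (L α) (N α))
    {p q : ∀ α, σ α} : hashRel N p q → hashRel N q p :=
  fun ⟨α, h⟩ => ⟨α, (hN α).mem_symm (hL α) h⟩

theorem not_hashRel_self (hL : ∀ α, IsSCS (L α)) (hN : ∀ α, IsOrtho (L α) (N α))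
    (p : ∀ α, σ α) : ¬ hashRel N p p :=
  fun ⟨α, h⟩ => (hN α).notMem_self (hL α) _ h

/-- Distinct atoms of the separated product are separated by their orthocomplements. -/
theorem exists_hashRel_not_hashRel (hL : ∀ α, IsSCS (L α)) (hN : ∀ α, IsOrtho (L α) (N α))
    {p q : ∀ α, σ α} (h : q ≠ p) : ∃ y, hashRel N y p ∧ ¬ hashRel N y q := by
  classical
  obtain ⟨β, hβ⟩ := Function.ne_iff.1 h
  obtain ⟨x, hx, hx'⟩ := (hN β).exists_mem_notMem (hL β) hβ
  refine ⟨Function.update q β x, ⟨β, by simpa using hx⟩, ?_⟩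
  rintro ⟨α, hα⟩
  rcases eq_or_ne α β with rfl | hne
  · exact hx' (by simpa using hα)
  · rw [Function.update_of_ne hne] at hα
    exact (hN α).notMem_self (hL α) _ hα

theorem subset_sharp_sharp (hL : ∀ α, IsSCS (L α)) (hN : ∀ α, IsOrtho (L α) (N α))
    (R : Set (∀ α, σ α)) : R ⊆ sharp N (sharp N R) :=
  fun p hp _ hq => hashRel_symm hL hN (hq p hp)

/-- A pair of atoms which differ in exactly the two coordinates `β` and `γ` is closed. -/
theorem sharp_sharp_pair (hL : ∀ α, IsSCS (L α)) (hN : ∀ α, IsOrtho (L α) (N α))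
    {p q : ∀ α, σ α} {β γ : Ω} (hne : β ≠ γ) (hβ : p β ≠ q β) (hγ : p γ ≠ q γ)
    (hpq : ∀ α, α ≠ β → α ≠ γ → p α = q α) : sharp N (sharp N {p, q}) = {p, q} := by
  classical
  refine Set.Subset.antisymm (fun s hs => ?_) (subset_sharp_sharp hL hN _)
  have key : ∀ δ ε, δ ≠ ε → ∀ u v : ∀ α, σ α, ({p, q} : Set (∀ α, σ α)) ⊆ {u, v} →
      s δ = u δ ∨ s ε = v ε := by
    intro δ ε hδε u v huv
    by_contra! hcon
    obtain ⟨x, hx, hx'⟩ := (hN δ).exists_mem_notMem (hL δ) hcon.1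
    obtain ⟨y, hy, hy'⟩ := (hN ε).exists_mem_notMem (hL ε) hcon.2
    have hmem : Function.update (Function.update s δ x) ε y ∈ sharp N {p, q} := by
      intro w hw
      rcases huv hw with rfl | rfl
      · exact ⟨δ, by simpa [Function.update_of_ne hδε] using hx⟩
      · exact ⟨ε, by simpa using hy⟩
    obtain ⟨α, hα⟩ := hashRel_symm hL hN (hs _ hmem)
    rcases eq_or_ne α ε with rfl | h1
    · exact hy' (by simpa using hα)
    rw [Function.update_of_ne h1] at hα
    rcases eq_or_ne α δ with rfl | h2
    · exact hx' (by simpa using hα)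
    rw [Function.update_of_ne h2] at hα
    exact (hN α).notMem_self (hL α) _ hα
  have hother : ∀ α, α ≠ β → α ≠ γ → s α = p α := by
    intro α h1 h2
    by_contra hcon
    obtain ⟨x, hx, hx'⟩ := (hN α).exists_mem_notMem (hL α) hcon
    have hmem : Function.update s α x ∈ sharp N {p, q} := by
      rintro w (rfl | rfl)
      · exact ⟨α, by simpa using hx⟩
      · exact ⟨α, by simpa [← hpq α h1 h2] using hx⟩
    obtain ⟨δ, hδ⟩ := hashRel_symm hL hN (hs _ hmem)
    rcases eq_or_ne δ α with rfl | h3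
    · exact hx' (by simpa using hδ)
    rw [Function.update_of_ne h3] at hδ
    exact (hN δ).notMem_self (hL δ) _ hδ
  have k1 := key β γ hne p q subset_rfl
  have k2 := key β γ hne q p (Set.pair_comm p q).subset
  rcases k1 with h1 | h1
  · left
    have h2 : s γ = p γ := k2.resolve_left fun e => hβ (h1.symm.trans e)
    funext α
    by_cases e1 : α = β
    · exact e1 ▸ h1
    by_cases e2 : α = γ
    · exact e2 ▸ h2
    exact hother α e1 e2
  · right
    have h2 : s β = q β := k2.resolve_right fun e => hγ (e.symm.trans h1)
    funext α
    by_cases e1 : α = β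
    · exact e1 ▸ h2
    by_cases e2 : α = γ
    · exact e2 ▸ h1
    exact (hother α e1 e2).trans (hpq α e1 e2)

/-- The coatoms of the separated product are the sets `{s}^#`. -/
theorem eq_univ_of_forall_not_subset (hL : ∀ α, IsSCS (L α)) (hN : ∀ α, IsOrtho (L α) (N α))
    {b : Set (∀ α, σ α)} (hb : b ∈ wedgeO L) (h : ∀ s, ¬ b ⊆ sharp N {s}) : b = Set.univ := by
  obtain ⟨ω, hω, rfl⟩ := hb
  refine Set.sInter_eq_univ.2 fun y hy => ?_
  obtain ⟨a, ha, rfl⟩ := hω y hy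
  by_contra hne
  have hc : ∀ α, ∃ s, a α ⊆ N α {s} := fun α =>
    (hN α).exists_subset_singleton (hL α) (ha α) fun hu =>
      hne (Set.eq_univ_of_forall fun x => ⟨α, hu ▸ Set.mem_univ _⟩)
  choose s hs using hc
  refine h s ((Set.sInter_subset_of_mem hy).trans ?_)
  rintro x ⟨α, hα⟩ _ rfl
  exact ⟨α, hs α hα⟩

theorem sharp_anti {R S : Set (∀ α, σ α)} (h : R ⊆ S) : sharp N S ⊆ sharp N R :=
  fun _ hq p hp => hq p (h hp)

theorem not_covProp_of_pair (hL : ∀ α, IsSCS (L α)) (hN : ∀ α, IsOrtho (L α) (N α))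
    {p q : ∀ α, σ α} (hne : p ≠ q) (hpq : ¬ hashRel N p q)
    (hcl : sharp N (sharp N {p, q}) = {p, q}) : ¬ CovProp (wedgeO L) := by
  intro h
  have hp : p ∉ sharp N {p, q} := fun hp => not_hashRel_self hL hN p (hp p (by simp))
  obtain ⟨-, -, -, hcov⟩ := h p _ (sharp_mem_wedgeO hL hN {p, q}) hp
  have hu : cl (wedgeO L) (insert p (sharp N {p, q})) = Set.univ := by
    refine Set.sInter_eq_univ.2 ?_
    rintro b ⟨hb, hsub⟩
    refine eq_univ_of_forall_not_subset hL hN hb fun s hs => ?_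
    have hps : hashRel N p s := hs (hsub (Set.mem_insert _ _)) s rfl
    have hmem : s ∈ sharp N (sharp N {p, q}) := fun x hx =>
      hashRel_symm hL hN (hs (hsub (Set.mem_insert_of_mem _ hx)) s rfl)
    rw [hcl] at hmem
    rcases hmem with rfl | rfl
    · exact not_hashRel_self hL hN _ hps
    · exact hpq hps
  rw [hu] at hcov
  refine hcov (sharp N {p}) (sharp_mem_wedgeO hL hN _) ?_ ?_
  · refine (Set.ssubset_iff_of_subset (sharp_anti (by simp))).2 ?_
    obtain ⟨y, hy, hy'⟩ := exists_hashRel_not_hashRel hL hN hne.symm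
    exact ⟨y, fun _ hx => hx ▸ hy, fun hx => hy' (hx q (by simp))⟩
  · exact Set.ssubset_univ_iff.2 fun e =>
      not_hashRel_self hL hN p ((e ▸ Set.mem_univ p : p ∈ sharp N {p}) p rfl)

theorem not_orthomodularIn_of_pair (hL : ∀ α, IsSCS (L α)) (hN : ∀ α, IsOrtho (L α) (N α))
    {p q : ∀ α, σ α} (hne : p ≠ q) (hpq : ¬ hashRel N p q)
    (hcl : sharp N (sharp N {p, q}) = {p, q}) :
    ¬ OrthomodularIn (wedgeO L) (sharp N) := by
  intro h
  have hpair : ({p, q} : Set (∀ α, σ α)) ∈ wedgeO L := hcl ▸ sharp_mem_wedgeO hL hN _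
  have hsub : sharp N (sharp N {p}) ⊆ {p, q} := by
    rw [← hcl]
    exact sharp_anti (sharp_anti (by simp))
  have hb := h _ (sharp_mem_wedgeO hL hN (sharp N {p})) _ hpair hsub
  have hempty : {p, q} ∩ sharp N (sharp N (sharp N {p})) = ∅ := by
    refine Set.eq_empty_of_forall_notMem ?_
    rintro x ⟨hx, hx'⟩
    have hxp : hashRel N x p := hx' p (subset_sharp_sharp hL hN _ rfl)
    rcases hx with rfl | rfl
    · exact not_hashRel_self hL hN _ hxp
    · exact hpq (hashRel_symm hL hN hxp)
  rw [hempty, Set.union_empty] at hb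
  have hq : q ∈ cl (wedgeO L) (sharp N (sharp N {p})) := hb ▸ by simp
  have hq' : q ∈ sharp N (sharp N {p}) := hq _ ⟨sharp_mem_wedgeO hL hN _, subset_rfl⟩
  obtain ⟨y, hy, hy'⟩ := exists_hashRel_not_hashRel hL hN hne.symm
  exact hy' (hashRel_symm hL hN (hq' y fun _ hx => hx ▸ hy))

end Sharp

/-- Aerts: for orthocomplemented simple closure spaces `L_α`, if
`∧○_α L_α` (with the orthocomplementation `R ↦ R^#`) has the covering property or is
orthomodular, then at most one `L_β` is not a power set. -/
theorem stmt18 {Ω : Type*} {σ : Ω → Type*} [∀ α, Nonempty (σ α)]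
    (L : ∀ α, Set (Set (σ α))) (hL : ∀ α, IsSCS (L α))
    (N : ∀ α, Set (σ α) → Set (σ α)) (hN : ∀ α, IsOrtho (L α) (N α))
    (h : CovProp (wedgeO L) ∨ OrthomodularIn (wedgeO L) (sharp N)) :
    ∀ β γ : Ω, L β ≠ (Set.univ : Set (Set (σ β))) →
      L γ ≠ (Set.univ : Set (Set (σ γ))) → β = γ := by
  classical
  intro β γ hβ hγ
  by_contra hne
  obtain ⟨p₁, q₁, h₁, o₁⟩ := (hN β).exists_ne_not_orthogonal (hL β) hβ
  obtain ⟨p₂, q₂, h₂, o₂⟩ := (hN γ).exists_ne_not_orthogonal (hL γ) hγ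
  let r : ∀ α, σ α := fun α => Classical.arbitrary (σ α)
  let p : ∀ α, σ α := Function.update (Function.update r β p₁) γ p₂
  let q : ∀ α, σ α := Function.update (Function.update r β q₁) γ q₂
  have pβ : p β = p₁ := by simp [p, Function.update_of_ne hne]
  have qβ : q β = q₁ := by simp [q, Function.update_of_ne hne]
  have pγ : p γ = p₂ := by simp [p]
  have qγ : q γ = q₂ := by simp [q]
  have hr : ∀ α, α ≠ β → α ≠ γ → p α = q α := fun α h1 h2 => by
    simp [p, q, Function.update_of_ne h1, Function.update_of_ne h2]
  have hpqβ : p β ≠ q β := by rwa [pβ, qβ]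
  have hpq : ¬ hashRel N p q := by
    rintro ⟨α, hα⟩
    by_cases h1 : α = β
    · subst h1
      rw [pβ, qβ] at hα
      exact o₁ hα
    by_cases h2 : α = γ
    · subst h2
      rw [pγ, qγ] at hα
      exact o₂ hα
    rw [hr α h1 h2] at hα
    exact (hN α).notMem_self (hL α) _ hα
  have hcl := sharp_sharp_pair hL hN hne hpqβ (by rwa [pγ, qγ]) hr
  have hne' : p ≠ q := fun e => hpqβ (congrFun e β)
  exact h.elim (not_covProp_of_pair hL hN hne' hpq hcl)
    (not_orthomodularIn_of_pair hL hN hne' hpq hcl)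


end QLTensor
end

section
/- Let {L_α}_{α∈Ω} be simple closure spaces, L_α on Σ_α. (1) If each L_α has the covering property and there is at most one β ∈ Ω with L_β ≠ 2^{Σ_β}, then ∨○_α L_α has the covering property. (2) Suppose each L_α different from 2^{Σ_α} contains MO_4; if ∨○_α L_α has the covering property, then there is at most one β ∈ Ω with L_β ≠ 2^{Σ_β}. -/
open Set

namespace QLTensor

universe u v w

section ClosureSpace

variable {X : Type*} {L : Set (Set X)}

lemma subset_cl (L : Set (Set X)) (A : Set X) : A ⊆ cl L A :=
  fun _ hx _ hb => hb.2 hx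

lemma cl_subset {A B : Set X} (hB : B ∈ L) (h : A ⊆ B) : cl L A ⊆ B :=
  fun _ hx => hx B ⟨hB, h⟩

lemma cl_mem (hL : ∀ ω ⊆ L, ⋂₀ ω ∈ L) (A : Set X) : cl L A ∈ L :=
  hL _ fun _ hb => hb.1

lemma inter_mem (hL : ∀ ω ⊆ L, ⋂₀ ω ∈ L) {A B : Set X} (hA : A ∈ L) (hB : B ∈ L) :
    A ∩ B ∈ L := by
  rw [← sInter_pair]
  exact hL _ (by rintro _ (rfl | rfl) <;> assumption)

lemma IsSCS.mem_of_subsingleton (hL : IsSCS L) {A : Set X} (hA : A.Subsingleton) : A ∈ L := by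
  rcases hA.eq_empty_or_singleton with rfl | ⟨x, rfl⟩
  · exact hL.2.1
  · exact hL.2.2.2 x

/-- An element strictly above the lower end of a covering pair and meeting the upper end
outside the lower end contains the upper end. -/
lemma CoversIn.subset_of_mem (hL : ∀ ω ⊆ L, ⋂₀ ω ∈ L) {a b c : Set X} (h : CoversIn L a b)
    (hc : c ∈ L) (hac : a ⊆ c) {x : X} (hxc : x ∈ c) (hxb : x ∈ b) (hxa : x ∉ a) : b ⊆ c := by
  by_contra hbc
  exact h.2.2.2 (c ∩ b) (inter_mem hL hc h.2.1)
    ⟨subset_inter hac h.2.2.1.subset, fun h' => hxa (h' ⟨hxc, hxb⟩)⟩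
    ⟨inter_subset_right, fun h' => hbc fun y hy => (h' hy).1⟩

/-- The covering property is equivalent to the exchange property. -/
lemma covProp_iff_exchange (hL : ∀ ω ⊆ L, ⋂₀ ω ∈ L) :
    CovProp L ↔ ∀ a ∈ L, ∀ p ∉ a, ∀ q ∉ a, q ∈ cl L (insert p a) →
      ∀ c ∈ L, a ⊆ c → q ∈ c → p ∈ c := by
  constructor
  · intro h a ha p hp q hq hqp c hc hac hqc
    exact (h p a ha hp).subset_of_mem hL hc hac hqc hqp hq (subset_cl _ _ (mem_insert _ _))
  · intro h p a ha hp
    refine ⟨ha, cl_mem hL _, ⟨(subset_insert p a).trans (subset_cl _ _),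
      fun h' => hp (h' (subset_cl _ _ (mem_insert _ _)))⟩, ?_⟩
    intro c hc hac hcb
    obtain ⟨q, hqc, hqa⟩ := exists_of_ssubset hac
    exact hcb.2 (cl_subset hc (insert_subset
      (h a ha p hp q hqa (hcb.1 hqc) c hc hac.1 hqc) hac.1))

lemma ContainsMO4.exists_line (hL : ∀ ω ⊆ L, ⋂₀ ω ∈ L) (h : ContainsMO4 L) :
    ∃ P : Fin 4 → X, Function.Injective P ∧
      ∀ A ∈ L, ∀ i j, i ≠ j → P i ∈ A → P j ∈ A → ∀ k, P k ∈ A := by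
  obtain ⟨p₁, p₂, p₃, p₄, h12, h13, h14, h23, h24, h34, c1, c2, c3, c4⟩ := h
  have hinj : Function.Injective ![p₁, p₂, p₃, p₄] := by
    intro i j hij
    fin_cases i <;> fin_cases j <;> simp_all
  have hcov : ∀ i, CoversIn L {![p₁, p₂, p₃, p₄] i} (cl L {p₁, p₄}) := by
    intro i
    fin_cases i <;> assumption
  have hmem i : ![p₁, p₂, p₃, p₄] i ∈ cl L {p₁, p₄} := (hcov i).2.2.1.1 rfl
  refine ⟨_, hinj, fun A hA i j hij hi hj k => ?_⟩
  exact (hcov i).subset_of_mem hL hA (singleton_subset_iff.2 hi) hj (hmem j)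
    (fun h' => hij (hinj h').symm) (hmem k)

end ClosureSpace

section Product

variable {Ω : Type*} {σ : Ω → Type*} {L : ∀ α, Set (Set (σ α))}

lemma mem_secSet [DecidableEq Ω] {R : Set (∀ α, σ α)} {β : Ω} {p : ∀ α, σ α} {x : σ β} :
    x ∈ secSet R β p ↔ Function.update p β x ∈ R := by
  constructor
  · rintro ⟨q, hq, rfl, h⟩
    rwa [← (Function.eq_update_iff.2 ⟨rfl, h⟩ : q = _)]
  · intro h
    exact ⟨_, h, Function.update_self .., fun α hα => Function.update_of_ne hα ..⟩

lemma sInter_mem_veeO (hL : ∀ α, IsSCS (L α)) :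
    ∀ ω ⊆ veeO L, ⋂₀ ω ∈ veeO L := by
  classical
  intro ω hω β p
  have : secSet (⋂₀ ω) β p = ⋂₀ ((fun R => secSet R β p) '' ω) := by
    ext x
    simp [mem_secSet]
  rw [this]
  refine (hL β).1 _ ?_
  rintro _ ⟨R, hR, rfl⟩
  exact hω hR β p

/-- A set whose distinct points differ in at least two coordinates belongs to `veeO L`. -/
lemma mem_veeO_of_separated (hL : ∀ α, IsSCS (L α)) {R : Set (∀ α, σ α)}
    (hR : ∀ q ∈ R, ∀ r ∈ R, ∀ β, (∀ α, α ≠ β → q α = r α) → q = r) : R ∈ veeO L := by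
  intro β p
  refine (hL β).mem_of_subsingleton ?_
  rintro _ ⟨q, hq, rfl, hqp⟩ _ ⟨r, hr, rfl, hrp⟩
  rw [hR q hq r hr β fun α hα => (hqp α hα).trans (hrp α hα).symm]

lemma covProp_veeO_of_forall_ne (hL : ∀ α, IsSCS (L α)) {β : Ω} (hβ : CovProp (L β))
    (h : ∀ α, α ≠ β → L α = univ) : CovProp (veeO L) := by
  classical
  rw [covProp_iff_exchange (sInter_mem_veeO hL)]
  rw [covProp_iff_exchange (hL β).1] at hβ
  intro R hR p hp q hq hqp c hc hRc hqc
  set T := cl (L β) (insert (p β) (secSet R β p)) with hT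
  have hS : R ∪ {r | r β ∈ T ∧ ∀ α, α ≠ β → r α = p α} ∈ veeO L := by
    intro α s
    by_cases hα : α = β
    · subst hα
      by_cases hs : ∀ γ, γ ≠ α → s γ = p γ
      · convert cl_mem (hL α).1 (insert (p α) (secSet R α p)) using 1
        ext x
        constructor
        · rintro ⟨r, hr | hr, rfl, hrs⟩
          · exact subset_cl _ _ (mem_insert_of_mem _
              ⟨r, hr, rfl, fun γ hγ => (hrs γ hγ).trans (hs γ hγ)⟩)
          · exact hr.1
        · intro hx
          refine mem_secSet.2 (Or.inr ⟨by simpa using hx, fun γ hγ => ?_⟩)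
          rw [Function.update_of_ne hγ, hs γ hγ]
      · convert hR α s using 1
        ext x
        constructor
        · rintro ⟨r, hr | hr, rfl, hrs⟩
          · exact ⟨r, hr, rfl, hrs⟩
          · exact absurd (fun γ hγ => (hrs γ hγ).symm.trans (hr.2 γ hγ)) hs
        · rintro ⟨r, hr, hrx⟩
          exact ⟨r, Or.inl hr, hrx⟩
    · rw [h α hα]
      trivial
  have hpT : p β ∈ T := subset_cl _ _ (mem_insert _ _)
  obtain hqR | ⟨hqT, hqp'⟩ := cl_subset hS
    (insert_subset (Or.inr ⟨hpT, fun _ _ => rfl⟩) subset_union_left) hqp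
  · exact absurd hqR hq
  have hupd : Function.update p β (q β) = q :=
    (Function.eq_update_iff.2 ⟨rfl, hqp'⟩ : q = _).symm
  have := hβ _ (hR β p) (p β) (by simpa [mem_secSet] using hp) (q β)
    (by rwa [mem_secSet, hupd]) hqT _ (hc β p)
    (fun x hx => mem_secSet.2 (hRc (mem_secSet.1 hx))) (by rwa [mem_secSet, hupd])
  simpa [mem_secSet] using this

lemma not_covProp_veeO [∀ α, Nonempty (σ α)] (hL : ∀ α, IsSCS (L α)) {β γ : Ω} (hne : β ≠ γ)
    (hβ : ContainsMO4 (L β)) (hγ : ContainsMO4 (L γ)) : ¬ CovProp (veeO L) := by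
  classical
  rw [covProp_iff_exchange (sInter_mem_veeO hL)]
  intro hex
  obtain ⟨P, hP, hPline⟩ := hβ.exists_line (hL β).1
  obtain ⟨Q, hQ, hQline⟩ := hγ.exists_line (hL γ).1
  let s : ∀ α, σ α := fun α => Classical.arbitrary _
  let x : Fin 4 → Fin 4 → ∀ α, σ α := fun i j =>
    Function.update (Function.update s β (P i)) γ (Q j)
  have hxβ i j : x i j β = P i := by simp [x, hne]
  have hxγ i j : x i j γ = Q j := by simp [x]
  have hx_inj {i j k l} (h : x i j = x k l) : i = k ∧ j = l :=
    ⟨hP (by rw [← hxβ i j, h, hxβ]), hQ (by rw [← hxγ i j, h, hxγ])⟩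
  have hdiag (I : Set (Fin 4)) : (fun i => x i i) '' I ∈ veeO L := by
    refine mem_veeO_of_separated hL ?_
    rintro _ ⟨i, -, rfl⟩ _ ⟨j, -, rfl⟩ α hα
    have hij : i = j := by
      by_cases h : β = α
      · exact hQ (by simpa only [hxγ] using hα γ (h ▸ hne.symm))
      · exact hP (by simpa only [hxβ] using hα β h)
    rw [hij]
  have hlineγ {c} (hc : c ∈ veeO L) (i j j' k) (hj : j ≠ j') (h : x i j ∈ c)
      (h' : x i j' ∈ c) : x i k ∈ c :=
    mem_secSet.1 (hQline _ (hc γ _) j j' hj (mem_secSet.2 h) (mem_secSet.2 h') k)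
  have hlineβ {c} (hc : c ∈ veeO L) (j i i' k) (hi : i ≠ i') (h : x i j ∈ c)
      (h' : x i' j ∈ c) : x k j ∈ c := by
    have hcomm i : x i j = Function.update (Function.update s γ (Q j)) β (P i) :=
      Function.update_comm hne ..
    rw [hcomm] at *
    exact mem_secSet.1 (hPline _ (hc β _) i i' hi (mem_secSet.2 h)
      (mem_secSet.2 (hcomm i' ▸ h')) k)
  have hoff (I : Set (Fin 4)) : x 0 1 ∉ (fun i => x i i) '' I := by
    rintro ⟨i, -, hi⟩
    obtain ⟨h0, h1⟩ := hx_inj hi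
    exact absurd (h0.symm.trans h1) (by decide)
  refine hoff univ (hex _ (hdiag {3}ᶜ) _ (hoff _) (x 3 3) ?_ ?_ _ (hdiag univ)
    (image_mono (subset_univ _)) ⟨3, trivial, rfl⟩)
  · rintro ⟨i, hi, h⟩
    exact hi (hx_inj h).1
  · rintro c ⟨hc, hsub⟩
    have h01 : x 0 1 ∈ c := hsub (mem_insert _ _)
    have hii (i : Fin 4) (hi : i ≠ 3) : x i i ∈ c := hsub (mem_insert_of_mem _ ⟨i, hi, rfl⟩)
    have h02 := hlineγ hc 0 0 1 2 (by decide) (hii 0 (by decide)) h01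
    have h31 := hlineβ hc 1 0 1 3 (by decide) h01 (hii 1 (by decide))
    have h32 := hlineβ hc 2 0 2 3 (by decide) h02 (hii 2 (by decide))
    exact hlineγ hc 3 1 2 3 (by decide) h31 h32

end Product

/-- (1) if each `L_α` has the covering property and at most one of them is
not a power set, then `∨○_α L_α` has the covering property; (2) if every `L_α` which is
not a power set contains `MO₄` and `∨○_α L_α` has the covering property, then at most one
`L_α` is not a power set. -/
theorem stmt19 {Ω : Type*} {σ : Ω → Type*} [∀ α, Nonempty (σ α)]
    (L : ∀ α, Set (Set (σ α))) (hL : ∀ α, IsSCS (L α)) :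
    ((∀ α, CovProp (L α)) →
      (∀ β γ : Ω, L β ≠ (Set.univ : Set (Set (σ β))) →
        L γ ≠ (Set.univ : Set (Set (σ γ))) → β = γ) →
      CovProp (veeO L)) ∧
    ((∀ α, L α ≠ (Set.univ : Set (Set (σ α))) → ContainsMO4 (L α)) →
      CovProp (veeO L) →
      ∀ β γ : Ω, L β ≠ (Set.univ : Set (Set (σ β))) →
        L γ ≠ (Set.univ : Set (Set (σ γ))) → β = γ) := by
  refine ⟨fun hcov huniq => ?_, fun hMO hcov β γ hβ hγ => ?_⟩
  · by_cases h : ∃ β, ∀ α, α ≠ β → L α = univ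
    · obtain ⟨β, hβ⟩ := h
      exact covProp_veeO_of_forall_ne hL (hcov β) hβ
    · push Not at h
      have : IsEmpty Ω := by
        refine ⟨fun β => ?_⟩
        obtain ⟨γ, -, hγ⟩ := h β
        obtain ⟨δ, hδγ, hδ⟩ := h γ
        exact hδγ (huniq δ γ hδ hγ)
      rw [covProp_iff_exchange (sInter_mem_veeO hL)]
      intro _ _ p _ q _ _ c _ _ hq
      rwa [Subsingleton.elim p q]
  · by_contra hne
    exact not_covProp_veeO hL hne (hMO β hβ) (hMO γ hγ) hcov

end QLTensor
end
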